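/- Let u, v be words over A with |v| ≤ |u|, and set N = |v|·(|u|−|v|). Then binom_q(u,v) = reflect_N(binom_q(ũ, ṽ)), where ũ, ṽ denote the reversals of u, v and reflect_N(P) is the polynomial q^N·P(1/q) (this is well defined since binom_q(ũ,ṽ) has degree at most N). -/

import Mathlib

noncomputable def qbinAux {A : Type*} [DecidableEq A] : List A → List A → Polynomial ℕ
  | _, [] => 1
  | [], _ :: _ => 0
  | a :: u, b :: v =>
      Polynomial.X ^ (v.length + 1) * qbinAux u (b :: v) +
        (if a = b then qbinAux u v else 0)

/-- The `q`-binomial coefficient `binom_q(u,v)` of two words. -/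
noncomputable def qbin {A : Type*} [DecidableEq A] (u v : List A) : Polynomial ℕ :=
  qbinAux u.reverse v.reverse

theorem qbinAux_nil_right {A : Type*} [DecidableEq A] (u : List A) : qbinAux u [] = 1 := by
  cases u <;> simp [qbinAux]

theorem qbinAux_eq_zero_of_length_lt {A : Type*} [DecidableEq A] (u v : List A)
    (h : u.length < v.length) : qbinAux u v = 0 := by
  induction u generalizing v with
  | nil => cases v <;> simp_all [qbinAux]
  | cons a u ih =>
    cases v with
    | nil => simp at h
    | cons b v =>
      simp only [List.length_cons] at h
      simp [qbinAux, ih v (by lia), ih (b :: v) (by simp; lia)]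

/-- The recursion of `qbinAux` at the other end of the words. -/
theorem qbinAux_concat {A : Type*} [DecidableEq A] (u v : List A) (a b : A) :
    qbinAux (u ++ [a]) (v ++ [b]) = qbinAux u (v ++ [b]) +
      if a = b then Polynomial.X ^ (u.length - v.length) * qbinAux u v else 0 := by
  induction u generalizing v with
  | nil => cases v <;> simp [qbinAux, qbinAux_eq_zero_of_length_lt]
  | cons c u ih =>
    cases v with
    | nil =>
      have h := ih []
      simp only [List.nil_append, qbinAux_nil_right] at h
      simp only [List.nil_append, List.cons_append, qbinAux, h, qbinAux_nil_right]
      split_ifs <;> simp <;> ring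
    | cons d v =>
      have h := ih (d :: v)
      simp only [List.cons_append, List.length_cons] at h
      simp only [List.cons_append, qbinAux, h, ih v, List.length_append, List.length_cons,
        List.length_nil, Nat.add_sub_add_right]
      by_cases huv : u.length < (d :: v).length
      · rw [qbinAux_eq_zero_of_length_lt u (d :: v) huv]
        split_ifs <;> ring
      · obtain ⟨m, hm⟩ := Nat.exists_eq_add_of_le (not_lt.mp huv)
        simp only [List.length_cons] at hm
        rw [show u.length - (v.length + 1) = m by lia, show u.length - v.length = m + 1 by lia]
        split_ifs <;> ring

theorem reflect_add_X_pow_mul (p : Polynomial ℕ) {M : ℕ} (n : ℕ) (hp : p.natDegree ≤ M) :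
    Polynomial.reflect (n + M) (Polynomial.X ^ n * p) = Polynomial.reflect M p := by
  rw [Polynomial.reflect_mul _ _ (Polynomial.natDegree_X_pow_le n) hp,
    Polynomial.reflect_monomial]
  simp

theorem reflect_add_eq_X_pow_mul (p : Polynomial ℕ) {M : ℕ} (n : ℕ) (hp : p.natDegree ≤ M) :
    Polynomial.reflect (n + M) p = Polynomial.X ^ n * Polynomial.reflect M p := by
  have h := Polynomial.reflect_mul 1 p (F := n) (by simp) hp
  rwa [one_mul, Polynomial.reflect_one] at h

theorem natDegree_qbinAux_le {A : Type*} [DecidableEq A] (u v : List A) :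
    (qbinAux u v).natDegree ≤ v.length * (u.length - v.length) := by
  induction u generalizing v with
  | nil => cases v <;> simp [qbinAux]
  | cons a u ih =>
    cases v with
    | nil => simp [qbinAux]
    | cons b v =>
      simp only [qbinAux, List.length_cons, Nat.add_sub_add_right]
      refine Polynomial.natDegree_add_le_of_degree_le ?_ ?_
      · by_cases huv : u.length < (b :: v).length
        · simp [qbinAux_eq_zero_of_length_lt u (b :: v) huv]
        · obtain ⟨m, hm⟩ := Nat.exists_eq_add_of_le (not_lt.mp huv)
          have h := ih (b :: v)
          simp only [List.length_cons] at hm h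
          rw [show u.length - (v.length + 1) = m by lia] at h
          rw [show u.length - v.length = m + 1 by lia]
          calc _ ≤ (v.length + 1) + (v.length + 1) * m :=
                Polynomial.natDegree_mul_le_of_le (Polynomial.natDegree_X_pow_le _) h
            _ = _ := by ring
      · split_ifs
        · exact (ih v).trans (Nat.mul_le_mul_right _ (Nat.le_succ _))
        · simp

theorem qbinAux_reverse {A : Type*} [DecidableEq A] (u v : List A) :
    qbinAux u.reverse v.reverse =
      Polynomial.reflect (v.length * (u.length - v.length)) (qbinAux u v) := by
  induction u generalizing v with
  | nil =>
    cases v with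
    | nil => simp [qbinAux]
    | cons b v => simpa [qbinAux] using qbinAux_eq_zero_of_length_lt [] (v.reverse ++ [b])
  | cons a u ih =>
    cases v with
    | nil => simp [qbinAux_nil_right]
    | cons b v =>
      have hb := ih (b :: v)
      rw [List.reverse_cons] at hb
      rw [List.reverse_cons, List.reverse_cons, qbinAux_concat, hb, ih v]
      simp only [qbinAux, List.length_cons, List.length_reverse, Nat.add_sub_add_right,
        Polynomial.reflect_add]
      congr 1
      · by_cases huv : u.length < (b :: v).length
        · simp [qbinAux_eq_zero_of_length_lt u (b :: v) huv]
        · obtain ⟨m, hm⟩ := Nat.exists_eq_add_of_le (not_lt.mp huv)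
          simp only [List.length_cons] at hm
          have hd := natDegree_qbinAux_le u (b :: v)
          rw [List.length_cons] at hd
          rw [← reflect_add_X_pow_mul _ (v.length + 1) hd]
          congr 1
          rw [show u.length - (v.length + 1) = m by lia, show u.length - v.length = m + 1 by lia]
          ring
      · split_ifs
        · rw [← reflect_add_eq_X_pow_mul _ _ (natDegree_qbinAux_le u v)]
          congr 1
          ring
        · simp

/-- For `|v| ≤ |u|` and `N = |v|(|u|-|v|)`, one has
`binom_q(u,v) = reflect_N (binom_q(ũ,ṽ))`, where `ũ, ṽ` are the reversals;
this is well defined since `binom_q(ũ,ṽ)` has degree at most `N`. -/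
theorem qbin_reverse (A : Type*) [Fintype A] [DecidableEq A]
    (u v : List A) (h : v.length ≤ u.length) :
    (qbin u.reverse v.reverse).natDegree ≤ v.length * (u.length - v.length) ∧
    qbin u v =
      Polynomial.reflect (v.length * (u.length - v.length)) (qbin u.reverse v.reverse) := by
  simp only [qbin, List.reverse_reverse]
  exact ⟨natDegree_qbinAux_le u v, qbinAux_reverse u v⟩
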